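/- Let (G,Ω) be an ample transitive ℓ-permutation group. Then T has a minimal element Δ whose o-primitive component is abelian (i.e. the group of restrictions to Δ of the elements of st(Δ) is abelian) if and only if there is h₁ ∈ G with h₁ > 1 such that [a,b] = 1 for all a,b ∈ G with |a| ∨ |b| ≤ h₁. In this case, if Δ is a minimal element of T and h₁ ∈ Q_Δ, then for x ∈ G one has x ∈ rst(Δ) if and only if there is h ∈ Q_Δ with h ≥ h₁ such that |x| ≤ h and, for all y ∈ G, |y| ≤ h implies [x,y] = 1. -/

import Mathlib

/-!  Common framework for ℓ-permutation groups on a totally ordered set. -/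

namespace LPerm

variable {Ω : Type*} [LinearOrder Ω]

/-- Pointwise join of two order automorphisms of a totally ordered set. -/
def autSup (f g : Ω ≃o Ω) : Ω ≃o Ω :=
  Equiv.toOrderIso
    { toFun := fun α => max (f α) (g α)
      invFun := fun α => min (f.symm α) (g.symm α)
      left_inv := by
        intro α
        dsimp only
        rcases le_total (f α) (g α) with h | h
        · rw [max_eq_right h]
          have h1 : α ≤ f.symm (g α) := by
            have := f.symm.monotone h
            simpa using this
          rw [g.symm_apply_apply, min_eq_right h1]
        · rw [max_eq_left h]
          have h1 : α ≤ g.symm (f α) := by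
            have := g.symm.monotone h
            simpa using this
          rw [f.symm_apply_apply, min_eq_left h1]
      right_inv := by
        intro α
        dsimp only
        rcases le_total (f.symm α) (g.symm α) with h | h
        · rw [min_eq_left h]
          have h1 : g (f.symm α) ≤ α := by
            have := g.monotone h
            simpa using this
          rw [f.apply_symm_apply, max_eq_left h1]
        · rw [min_eq_right h]
          have h1 : f (g.symm α) ≤ α := by
            have := f.monotone h
            simpa using this
          rw [g.apply_symm_apply, max_eq_right h1] }
    (f.monotone.max g.monotone)
    (f.symm.monotone.min g.symm.monotone)

/-- Pointwise meet of two order automorphisms of a totally ordered set. -/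
def autInf (f g : Ω ≃o Ω) : Ω ≃o Ω :=
  Equiv.toOrderIso
    { toFun := fun α => min (f α) (g α)
      invFun := fun α => max (f.symm α) (g.symm α)
      left_inv := by
        intro α
        dsimp only
        rcases le_total (f α) (g α) with h | h
        · rw [min_eq_left h]
          have h1 : g.symm (f α) ≤ α := by
            have := g.symm.monotone h
            simpa using this
          rw [f.symm_apply_apply, max_eq_left h1]
        · rw [min_eq_right h]
          have h1 : f.symm (g α) ≤ α := by
            have := f.symm.monotone h
            simpa using this
          rw [g.symm_apply_apply, max_eq_right h1]
      right_inv := by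
        intro α
        dsimp only
        rcases le_total (f.symm α) (g.symm α) with h | h
        · rw [max_eq_right h]
          have h1 : α ≤ f (g.symm α) := by
            have := f.monotone h
            simpa using this
          rw [g.apply_symm_apply, min_eq_right h1]
        · rw [max_eq_left h]
          have h1 : α ≤ g (f.symm α) := by
            have := g.monotone h
            simpa using this
          rw [f.apply_symm_apply, min_eq_left h1] }
    (f.monotone.min g.monotone)
    (f.symm.monotone.max g.symm.monotone)


/-- The pointwise order on order automorphisms: `f ≤ g` iff `f α ≤ g α` for all `α`. -/
def autLe (f g : Ω ≃o Ω) : Prop := ∀ α : Ω, f α ≤ g α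

/-- `|g| = g ∨ g⁻¹`. -/
def autAbs (g : Ω ≃o Ω) : Ω ≃o Ω := autSup g g⁻¹

/-- The support of an automorphism. -/
def supp (g : Ω ≃o Ω) : Set Ω := {α | g α ≠ α}

/-- Conjugation, written `h^g = g⁻¹ h g` in the paper. -/
def aconj (h g : Ω ≃o Ω) : Ω ≃o Ω := g⁻¹ * h * g

/-- The commutator `[a,b] = a⁻¹ b⁻¹ a b`. -/
def pcomm (a b : Ω ≃o Ω) : Ω ≃o Ω := a⁻¹ * b⁻¹ * a * b

/-- `G` is closed under the pointwise lattice operations, i.e. `(G,Ω)` is an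
ℓ-permutation group. -/
def SublatticeClosed (G : Subgroup (Ω ≃o Ω)) : Prop :=
  ∀ f g : Ω ≃o Ω, f ∈ G → g ∈ G → autSup f g ∈ G ∧ autInf f g ∈ G

/-- `(G,Ω)` is transitive. -/
def IsTransitive (G : Subgroup (Ω ≃o Ω)) : Prop :=
  ∀ α β : Ω, ∃ g ∈ G, g α = β

/-- `(G,Ω)` is o-2 transitive. -/
def IsO2Transitive (G : Subgroup (Ω ≃o Ω)) : Prop :=
  ∀ α₁ α₂ β₁ β₂ : Ω, α₁ < α₂ → β₁ < β₂ → ∃ g ∈ G, g α₁ = β₁ ∧ g α₂ = β₂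

/-- A convex `G`-congruence: an equivalence relation with convex classes which is
preserved by the action of `G`. -/
def IsConvexCongruence (G : Subgroup (Ω ≃o Ω)) (r : Ω → Ω → Prop) : Prop :=
  Equivalence r ∧ (∀ α β γ : Ω, r α γ → α ≤ β → β ≤ γ → r α β) ∧
    ∀ g ∈ G, ∀ α β : Ω, r α β → r (g α) (g β)

/-- `V(α,β)`: the intersection of all convex `G`-congruences under which `α` and `β`
are equivalent. -/
def Vcong (G : Subgroup (Ω ≃o Ω)) (α β : Ω) : Ω → Ω → Prop :=
  fun γ δ => ∀ r : Ω → Ω → Prop, IsConvexCongruence G r → r α β → r γ δ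

/-- Membership in the spine `𝔎` of `(G,Ω)`. -/
def SpineMem (G : Subgroup (Ω ≃o Ω)) (r : Ω → Ω → Prop) : Prop :=
  ∃ α β : Ω, α ≠ β ∧ r = Vcong G α β

/-- Inclusion of relations. -/
def relLe (r s : Ω → Ω → Prop) : Prop := ∀ x y : Ω, r x y → s x y

/-- `Δ ∈ T`: `Δ` is an o-block (class) of a member of the spine `𝔎`. -/
def InT (G : Subgroup (Ω ≃o Ω)) (Δ : Set Ω) : Prop :=
  ∃ r : Ω → Ω → Prop, SpineMem G r ∧ ∃ δ : Ω, Δ = {γ | r δ γ}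

/-- `Δ` is a class (o-block) of the relation `r`. -/
def IsBlockOf (r : Ω → Ω → Prop) (Δ : Set Ω) : Prop :=
  ∃ δ : Ω, Δ = {γ | r δ γ}

/-- The restricted stabiliser `rst(S) = {g ∈ G ∣ supp g ⊆ S}`. -/
def rst (G : Subgroup (Ω ≃o Ω)) (S : Set Ω) : Set (Ω ≃o Ω) :=
  {g | g ∈ G ∧ supp g ⊆ S}

/-- The (setwise) stabiliser `st(Δ) = {g ∈ G ∣ Δg = Δ}`. -/
def stab (G : Subgroup (Ω ≃o Ω)) (Δ : Set Ω) : Set (Ω ≃o Ω) :=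
  {g | g ∈ G ∧ g '' Δ = Δ}

/-- `Q_Δ = {h ∈ rst(Δ) ∣ ∃ α ∈ Δ, V(α, αh) = κ(Δ)}`; since `κ(Δ)` is the unique
convex congruence having `Δ` as a class, the condition `V(α,αh) = κ(Δ)` says exactly
that `Δ` is the class of `V(α, αh)` containing `α`. -/
def Qset (G : Subgroup (Ω ≃o Ω)) (Δ : Set Ω) : Set (Ω ≃o Ω) :=
  {h | h ∈ rst G Δ ∧ ∃ α ∈ Δ, Δ = {γ | Vcong G α (h α) α γ}}

/-- `(G,Ω)` is ample: `Q_Δ ≠ ∅` for every `Δ ∈ T`. -/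
def Ample (G : Subgroup (Ω ≃o Ω)) : Prop :=
  ∀ Δ : Set Ω, InT G Δ → (Qset G Δ).Nonempty

/-- `(G,Ω)` is abundant: for every `Δ ∈ T` and `g ∈ st(Δ)`, the automorphism
`dep(g,Δ)` agreeing with `g` on `Δ` and with the identity elsewhere lies in `G`. -/
def Abundant (G : Subgroup (Ω ≃o Ω)) : Prop :=
  ∀ Δ : Set Ω, InT G Δ → ∀ g ∈ stab G Δ,
    ∃ g₀ ∈ G, (∀ α ∈ Δ, g₀ α = g α) ∧ ∀ α ∉ Δ, g₀ α = α

/-- The spine `𝔎` has no minimal element. -/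
def SpineNoMin (G : Subgroup (Ω ≃o Ω)) : Prop :=
  ∀ r : Ω → Ω → Prop, SpineMem G r →
    ∃ r' : Ω → Ω → Prop, SpineMem G r' ∧ relLe r' r ∧ r' ≠ r

/-- `Δ` is a minimal element of `T`. -/
def MinimalInT (G : Subgroup (Ω ≃o Ω)) (Δ : Set Ω) : Prop :=
  InT G Δ ∧ ∀ Δ' : Set Ω, InT G Δ' → Δ' ⊆ Δ → Δ' = Δ

/-- Hypothesis (†): if `T` has a minimal element `Δ₀`, then every (nondegenerate
bounded) interval of `Δ₀` supports a non-trivial element of `G`. -/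
def Dagger (G : Subgroup (Ω ≃o Ω)) : Prop :=
  ∀ Δ₀ : Set Ω, MinimalInT G Δ₀ → ∀ α β : Ω, α ∈ Δ₀ → β ∈ Δ₀ → α < β →
    ∃ g : Ω ≃o Ω, g ∈ G ∧ g ≠ 1 ∧ supp g ⊆ Set.Ioo α β

/-- `X_h = {[h⁻¹, h^g] ∣ g ∈ G}`. -/
def Xset (G : Subgroup (Ω ≃o Ω)) (h : Ω ≃o Ω) : Set (Ω ≃o Ω) :=
  {x | ∃ g ∈ G, x = pcomm h⁻¹ (aconj h g)}

/-- `W_h = ⋃ {X_{h^g} ∣ g ∈ G, [X_h, X_{h^g}] ≠ 1}`. -/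
def Wset (G : Subgroup (Ω ≃o Ω)) (h : Ω ≃o Ω) : Set (Ω ≃o Ω) :=
  {x | ∃ g ∈ G, (∃ a ∈ Xset G h, ∃ b ∈ Xset G (aconj h g), pcomm a b ≠ 1) ∧
    x ∈ Xset G (aconj h g)}

/-- The centraliser of a subset `S` in `G`. -/
def cent (G : Subgroup (Ω ≃o Ω)) (S : Set (Ω ≃o Ω)) : Set (Ω ≃o Ω) :=
  {f | f ∈ G ∧ ∀ s ∈ S, s * f = f * s}

/-- The double centraliser of a subset `S` in `G`. -/
def cent2 (G : Subgroup (Ω ≃o Ω)) (S : Set (Ω ≃o Ω)) : Set (Ω ≃o Ω) :=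
  cent G (cent G S)

/-- The pointwise stabiliser in `G` of a subset `S ⊆ Ω`. -/
def ptStab (G : Subgroup (Ω ≃o Ω)) (S : Set Ω) : Set (Ω ≃o Ω) :=
  {f | f ∈ G ∧ ∀ α ∈ S, f α = α}

/-- The congruence covered by `K`: the union of all convex `G`-congruences properly
contained in `K`. -/
def coveredRel (G : Subgroup (Ω ≃o Ω)) (K : Ω → Ω → Prop) : Ω → Ω → Prop :=
  fun γ δ => ∃ r : Ω → Ω → Prop, IsConvexCongruence G r ∧ relLe r K ∧ r ≠ K ∧ r γ δ

/-- `Γ ∈ π(Δ)`, where `K = κ(Δ)`: `Γ` is a class of the congruence covered by `K`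
contained in `Δ`. -/
def InPi (G : Subgroup (Ω ≃o Ω)) (K : Ω → Ω → Prop) (Δ Γ : Set Ω) : Prop :=
  ∃ δ ∈ Δ, Γ = {γ | coveredRel G K δ γ}

/-- An irreducible element of `G`. -/
def IsIrreducibleElt (G : Subgroup (Ω ≃o Ω)) (g : Ω ≃o Ω) : Prop :=
  autLe 1 g ∧ g ≠ 1 ∧
    ∀ g₁ g₂ : Ω ≃o Ω, g₁ ∈ G → g₂ ∈ G → autSup g₁ g₂ = g → autInf g₁ g₂ = 1 →
      g₁ = 1 ∨ g₂ = 1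

/-- `(G,Ω)` is controlled. -/
def Controlled (G : Subgroup (Ω ≃o Ω)) : Prop :=
  ∀ Δ : Set Ω, InT G Δ → ¬ MinimalInT G Δ → ∀ g ∈ rst G Δ,
    (∃ δ ∈ Δ ∩ supp g, Δ = {γ | Vcong G δ (g δ) δ γ}) ∨
      ∃ Δ' : Set Ω, InT G Δ' ∧ supp g ⊆ Δ' ∧ Δ' ⊂ Δ


theorem autSup_apply (f g : Ω ≃o Ω) (x : Ω) : autSup f g x = max (f x) (g x) := rfl

theorem autInf_apply (f g : Ω ≃o Ω) (x : Ω) : autInf f g x = min (f x) (g x) := rfl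

theorem autAbs_apply (g : Ω ≃o Ω) (x : Ω) : autAbs g x = max (g x) (g⁻¹ x) := rfl

theorem autAbs_mem {G : Subgroup (Ω ≃o Ω)} (hlat : SublatticeClosed G) {g : Ω ≃o Ω}
    (hg : g ∈ G) : autAbs g ∈ G :=
  (hlat g g⁻¹ hg (G.inv_mem hg)).1

theorem le_autAbs_apply (g : Ω ≃o Ω) (x : Ω) : x ≤ autAbs g x := by
  rw [autAbs_apply, le_max_iff]
  by_contra! h
  have h2 := g.strictMono h.2
  rw [RelIso.apply_inv_self] at h2
  exact lt_asymm h.1 h2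

theorem autAbs_apply_eq_self_iff (g : Ω ≃o Ω) (x : Ω) : autAbs g x = x ↔ g x = x := by
  constructor
  · intro h
    rw [autAbs_apply] at h
    have h1 : g x ≤ x := (le_max_left _ _).trans h.le
    have h2 := g.monotone ((le_max_right (g x) (g⁻¹ x)).trans h.le)
    rw [RelIso.apply_inv_self] at h2
    exact le_antisymm h1 h2
  · intro h
    have h2 : g⁻¹ x = x := by
      conv_lhs => rw [← h]
      exact RelIso.inv_apply_self g x
    rw [autAbs_apply, h, h2, max_self]

theorem autAbs_eq_self {g : Ω ≃o Ω} (h : ∀ x, x ≤ g x) : autAbs g = g := by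
  ext x
  rw [autAbs_apply]
  apply max_eq_left
  have h2 := h (g⁻¹ x)
  rw [RelIso.apply_inv_self] at h2
  exact h2.trans (h x)

theorem pcomm_eq_one_iff (a b : Ω ≃o Ω) : pcomm a b = 1 ↔ Commute a b := by
  unfold pcomm Commute SemiconjBy
  constructor
  · intro h
    have h2 : a * b = b * a * (a⁻¹ * b⁻¹ * a * b) := by group
    rw [h2, h, mul_one]
  · intro h
    rw [mul_assoc, h]
    group

/-- Two automorphisms supported in `Δ` commute if they commute at the points of `Δ`. -/
theorem commute_of_supp_subset {a b : Ω ≃o Ω} {Δ : Set Ω} (ha : supp a ⊆ Δ) (hb : supp b ⊆ Δ)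
    (h : ∀ x ∈ Δ, a (b x) = b (a x)) : Commute a b := by
  ext x
  change a (b x) = b (a x)
  by_cases hx : x ∈ Δ
  · exact h x hx
  · have h1 : a x = x := by_contra fun h' => hx (ha h')
    have h2 : b x = x := by_contra fun h' => hx (hb h')
    rw [h2, h1, h2]

theorem mem_of_supp_subset {a : Ω ≃o Ω} {Δ : Set Ω} (ha : supp a ⊆ Δ) {x : Ω} (hx : x ∈ Δ) :
    a x ∈ Δ := by
  by_cases h : a x = x
  · rwa [h]
  · exact ha fun h' => h (a.injective h')

theorem image_eq_of_supp_subset {a : Ω ≃o Ω} {Δ : Set Ω} (ha : supp a ⊆ Δ) : a '' Δ = Δ := by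
  apply Set.Subset.antisymm
  · rintro _ ⟨x, hx, rfl⟩
    exact mem_of_supp_subset ha hx
  · intro x hx
    refine ⟨a⁻¹ x, ?_, RelIso.apply_inv_self a x⟩
    by_contra h
    have h1 : a (a⁻¹ x) = a⁻¹ x := by_contra fun h' => h (ha h')
    rw [RelIso.apply_inv_self] at h1
    exact h (h1 ▸ hx)

theorem supp_subset_of_autAbs_le {x h : Ω ≃o Ω} (hxh : autLe (autAbs x) h) :
    supp x ⊆ supp h := by
  intro y hy hh
  apply hy
  rw [← autAbs_apply_eq_self_iff]
  exact le_antisymm ((hxh y).trans_eq hh) (le_autAbs_apply x y)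

theorem supp_autAbs (g : Ω ≃o Ω) : supp (autAbs g) = supp g := by
  ext x
  exact not_congr (autAbs_apply_eq_self_iff g x)

/-! Convex congruences. -/

theorem isConvexCongruence_eq (G : Subgroup (Ω ≃o Ω)) : IsConvexCongruence G Eq :=
  ⟨eq_equivalence, fun _ _ _ h h1 h2 => le_antisymm h1 (h ▸ h2), fun g _ _ _ h => congrArg g h⟩

theorem isConvexCongruence_Vcong (G : Subgroup (Ω ≃o Ω)) (α β : Ω) :
    IsConvexCongruence G (Vcong G α β) :=
  ⟨⟨fun x _ hr _ => hr.1.refl x, fun h r hr hab => hr.1.symm (h r hr hab),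
      fun h h' r hr hab => hr.1.trans (h r hr hab) (h' r hr hab)⟩,
    fun x y z h h1 h2 r hr hab => hr.2.1 x y z (h r hr hab) h1 h2,
    fun g hg x y h r hr hab => hr.2.2 g hg x y (h r hr hab)⟩

theorem Vcong_self (G : Subgroup (Ω ≃o Ω)) (α β : Ω) : Vcong G α β α β := fun _ _ h => h

theorem inT_Vcong (G : Subgroup (Ω ≃o Ω)) {α β : Ω} (h : α ≠ β) (δ : Ω) :
    InT G {γ | Vcong G α β δ γ} :=
  ⟨_, ⟨α, β, h, rfl⟩, δ, rfl⟩

theorem IsConvexCongruence.of_mem_interval {G : Subgroup (Ω ≃o Ω)} {r : Ω → Ω → Prop}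
    (hr : IsConvexCongruence G r) {w x y z : Ω} (h1 : r w x) (h2 : r w z) (hxy : x ≤ y)
    (hyz : y ≤ z) : r w y :=
  hr.1.trans h1 (hr.2.1 x y z (hr.1.trans (hr.1.symm h1) h2) hxy hyz)

theorem InT.exists_ne {G : Subgroup (Ω ≃o Ω)} (htrans : IsTransitive G) {Δ : Set Ω}
    (h : InT G Δ) : ∃ x ∈ Δ, ∃ y ∈ Δ, x ≠ y := by
  obtain ⟨_, ⟨β, γ, hne, rfl⟩, δ, rfl⟩ := h
  obtain ⟨g, hg, rfl⟩ := htrans β δ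
  have hV := isConvexCongruence_Vcong G β γ
  exact ⟨g β, hV.1.refl _, g γ, hV.2.2 g hg _ _ (Vcong_self G β γ), fun h => hne (g.injective h)⟩

theorem exists_moved_of_mem_Qset {G : Subgroup (Ω ≃o Ω)} (htrans : IsTransitive G) {Δ : Set Ω}
    (hΔ : InT G Δ) {h : Ω ≃o Ω} (hh : h ∈ Qset G Δ) : ∃ α ∈ Δ, h α ≠ α := by
  obtain ⟨-, α, hα, hΔα⟩ := hh
  refine ⟨α, hα, fun hfix => ?_⟩
  obtain ⟨x, hx, y, hy, hxy⟩ := hΔ.exists_ne htrans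
  rw [hΔα] at hx hy
  exact hxy ((hx Eq (isConvexCongruence_eq G) hfix.symm).symm.trans
    (hy Eq (isConvexCongruence_eq G) hfix.symm))

/-- The convex class of a minimal block is generated by any two of its points. -/
theorem MinimalInT.eq_Vcong_class {G : Subgroup (Ω ≃o Ω)} {Δ : Set Ω} (hΔ : MinimalInT G Δ)
    {x y : Ω} (hx : x ∈ Δ) (hy : y ∈ Δ) (hxy : x ≠ y) : {γ | Vcong G x y x γ} = Δ := by
  apply hΔ.2 _ (inT_Vcong G hxy x)
  obtain ⟨_, ⟨β, γ, -, rfl⟩, δ, rfl⟩ := hΔ.1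
  have hV := isConvexCongruence_Vcong G β γ
  intro z hz
  exact hV.1.trans hx (hz _ hV (hV.1.trans (hV.1.symm hx) hy))

/-! Orbit hulls. -/

/-- `y` lies in the convex hull of the orbit of `x` under the powers of `f`. -/
def OrbitHull (f : Ω ≃o Ω) (x y : Ω) : Prop := ∃ m n : ℤ, (f ^ m) x ≤ y ∧ y ≤ (f ^ n) x

theorem zpow_neg_apply_le_iff (f : Ω ≃o Ω) (m : ℤ) (x y : Ω) :
    (f ^ (-m)) x ≤ y ↔ x ≤ (f ^ m) y := by
  rw [← (f ^ m).le_iff_le, zpow_neg, RelIso.apply_inv_self]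

theorem le_zpow_neg_apply_iff (f : Ω ≃o Ω) (m : ℤ) (x y : Ω) :
    y ≤ (f ^ (-m)) x ↔ (f ^ m) y ≤ x := by
  rw [← (f ^ m).le_iff_le, zpow_neg, RelIso.apply_inv_self]

theorem zpow_add_apply (f : Ω ≃o Ω) (m n : ℤ) (x : Ω) :
    (f ^ (m + n)) x = (f ^ m) ((f ^ n) x) := by
  rw [zpow_add]; rfl

theorem OrbitHull.equivalence (f : Ω ≃o Ω) : Equivalence (OrbitHull f) where
  refl x := ⟨0, 0, le_rfl, le_rfl⟩
  symm := by
    rintro x y ⟨m, n, h1, h2⟩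
    exact ⟨-n, -m, (zpow_neg_apply_le_iff f n y x).2 h2, (le_zpow_neg_apply_iff f m y x).2 h1⟩
  trans := by
    rintro x y z ⟨m, n, h1, h2⟩ ⟨m', n', h1', h2'⟩
    refine ⟨m' + m, n' + n, ?_, ?_⟩
    · rw [zpow_add_apply]
      exact ((f ^ m').monotone h1).trans h1'
    · rw [zpow_add_apply]
      exact h2'.trans ((f ^ n').monotone h2)

theorem OrbitHull.of_mem_interval {f : Ω ≃o Ω} {w x y z : Ω} (h1 : OrbitHull f w x)
    (h2 : OrbitHull f w z) (hxy : x ≤ y) (hyz : y ≤ z) : OrbitHull f w y := by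
  obtain ⟨m, -, hm, -⟩ := h1
  obtain ⟨-, n, -, hn⟩ := h2
  exact ⟨m, n, hm.trans hxy, hyz.trans hn⟩

theorem orbitHull_zpow (f : Ω ≃o Ω) (x : Ω) (k : ℤ) : OrbitHull f x ((f ^ k) x) :=
  ⟨k, k, le_rfl, le_rfl⟩

theorem orbitHull_apply (f : Ω ≃o Ω) (x : Ω) : OrbitHull f x (f x) := by
  simpa using orbitHull_zpow f x 1

theorem OrbitHull.eq_of_fixed {f : Ω ≃o Ω} {x y : Ω} (h : OrbitHull f x y) (hx : f x = x) :
    y = x := by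
  have key : ∀ k : ℤ, (f ^ k) x = x := by
    intro k
    have h1 : f ∈ MulAction.stabilizer (Ω ≃o Ω) x := hx
    exact (MulAction.stabilizer (Ω ≃o Ω) x).zpow_mem h1 k
  obtain ⟨m, n, hm, hn⟩ := h
  rw [key] at hm hn
  exact le_antisymm hn hm

theorem OrbitHull.map_of_commute {f g : Ω ≃o Ω} (hfg : Commute f g) {x y : Ω}
    (h : OrbitHull f x y) : OrbitHull f (g x) (g y) := by
  have key : ∀ (k : ℤ) (z : Ω), (f ^ k) (g z) = g ((f ^ k) z) := fun k z =>
    DFunLike.congr_fun (hfg.zpow_left k).eq z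
  obtain ⟨m, n, hm, hn⟩ := h
  refine ⟨m, n, ?_, ?_⟩
  · rw [key]; exact g.monotone hm
  · rw [key]; exact g.monotone hn

theorem equiv_zpow_apply {E : Ω → Ω → Prop} (hE : Equivalence E) {f : Ω ≃o Ω} {x : Ω}
    (h : ∀ k : ℤ, E ((f ^ k) x) (f ((f ^ k) x))) (k : ℤ) : E x ((f ^ k) x) := by
  have hs : ∀ k : ℤ, (f ^ (k + 1)) x = f ((f ^ k) x) := by
    intro k
    rw [add_comm, zpow_add_apply, zpow_one]
  induction k using Int.induction_on with
  | zero => exact hE.refl x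
  | succ n ih =>
    rw [hs]
    exact hE.trans ih (h _)
  | pred n ih =>
    have h1 := h (-n - 1)
    rw [← hs, sub_add_cancel] at h1
    exact hE.trans ih (hE.symm h1)

theorem OrbitHull.mono {b f : Ω ≃o Ω} (hb : ∀ x, x ≤ b x) (hbf : ∀ x, b x ≤ f x) {x y : Ω}
    (h : OrbitHull b x y) : OrbitHull f x y := by
  have key := equiv_zpow_apply (OrbitHull.equivalence f) (f := b) (x := x) fun k =>
    ((OrbitHull.equivalence f).refl _).of_mem_interval (orbitHull_apply f _) (hb _) (hbf _)
  obtain ⟨m, n, hm, hn⟩ := h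
  exact (key m).of_mem_interval (key n) hm hn

/-- If `b` commutes with `f` and agrees with it at `x`, then the hull of the `f`-orbit of `x`
is contained in that of the `b`-orbit. -/
theorem OrbitHull.of_commute_of_eq {b f : Ω ≃o Ω} (hbf : Commute b f) {x y : Ω}
    (hx : b x = f x) (h : OrbitHull f x y) : OrbitHull b x y := by
  have hx' : OrbitHull b x (f x) := hx ▸ orbitHull_apply b x
  have key := equiv_zpow_apply (OrbitHull.equivalence b) (f := f) (x := x) fun k => by
    have h1 := hx'.map_of_commute (hbf.zpow_right k)
    have h2 : f ((f ^ k) x) = (f ^ k) (f x) :=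
      DFunLike.congr_fun ((Commute.refl f).zpow_right k).eq x
    rwa [h2]
  obtain ⟨m, n, hm, hn⟩ := h
  exact (key m).of_mem_interval (key n) hm hn

/-! Positive elements below which the group is commutative. -/

/-- `f` is a positive element of `G` and the elements of the interval `[1, f]` of `G` commute. -/
structure AbelianBelow (G : Subgroup (Ω ≃o Ω)) (f : Ω ≃o Ω) : Prop where
  mem : f ∈ G
  pos : ∀ x, x ≤ f x
  comm : ∀ a ∈ G, ∀ b ∈ G, (∀ x, x ≤ a x) → (∀ x, a x ≤ f x) → (∀ x, x ≤ b x) →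
    (∀ x, b x ≤ f x) → Commute a b

theorem AbelianBelow.commute_self {G : Subgroup (Ω ≃o Ω)} {f : Ω ≃o Ω} (hf : AbelianBelow G f)
    {b : Ω ≃o Ω} (hb : b ∈ G) (h1 : ∀ x, x ≤ b x) (h2 : ∀ x, b x ≤ f x) : Commute b f :=
  hf.comm b hb f hf.mem h1 h2 hf.pos fun _ => le_rfl

theorem AbelianBelow.of_le {G : Subgroup (Ω ≃o Ω)} {f b : Ω ≃o Ω} (hf : AbelianBelow G f)
    (hb : b ∈ G) (h1 : ∀ x, x ≤ b x) (h2 : ∀ x, b x ≤ f x) : AbelianBelow G b :=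
  ⟨hb, h1, fun a ha a' ha' p q p' q' =>
    hf.comm a ha a' ha' p (fun x => (q x).trans (h2 x)) p' fun x => (q' x).trans (h2 x)⟩

theorem AbelianBelow.conj {G : Subgroup (Ω ≃o Ω)} {f c : Ω ≃o Ω} (hf : AbelianBelow G f)
    (hc : c ∈ G) : AbelianBelow G (c * f * c⁻¹) := by
  have hpos : ∀ {a : Ω ≃o Ω}, (∀ x, x ≤ a x) → ∀ x, x ≤ (c⁻¹ * a * c) x := by
    intro a ha x
    have h := (c⁻¹).monotone (ha (c x))
    rwa [RelIso.inv_apply_self] at h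
  have hle : ∀ {a : Ω ≃o Ω}, (∀ x, a x ≤ (c * f * c⁻¹) x) → ∀ x, (c⁻¹ * a * c) x ≤ f x := by
    intro a ha x
    have h := (c⁻¹).monotone (ha (c x))
    change _ ≤ c⁻¹ (c (f (c⁻¹ (c x)))) at h
    rwa [RelIso.inv_apply_self, RelIso.inv_apply_self] at h
  refine ⟨G.mul_mem (G.mul_mem hc hf.mem) (G.inv_mem hc), fun x => ?_, ?_⟩
  · have h := c.monotone (hf.pos (c⁻¹ x))
    rwa [RelIso.apply_inv_self] at h
  · intro a ha b hb a1 a2 b1 b2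
    have h := hf.comm (c⁻¹ * a * c) (G.mul_mem (G.mul_mem (G.inv_mem hc) ha) hc)
      (c⁻¹ * b * c) (G.mul_mem (G.mul_mem (G.inv_mem hc) hb) hc) (hpos a1) (hle a2)
      (hpos b1) (hle b2)
    have h' := (Commute.conj_iff c).2 h
    simpa [mul_assoc] using h'

theorem AbelianBelow.orbitHull_map_of_comparable {G : Subgroup (Ω ≃o Ω)}
    (hlat : SublatticeClosed G) {f c : Ω ≃o Ω} (hf : AbelianBelow G f) (hc : c ∈ G)
    (hcmp : (∀ x, x ≤ c x) ∨ ∀ x, c x ≤ x) {y z : Ω} (hy : OrbitHull f y (c y))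
    (hz : OrbitHull f y z) : OrbitHull f y (c z) := by
  have hR := OrbitHull.equivalence f
  have hf' := hf.conj hc
  set f' := c * f * c⁻¹ with hf'_def
  have hpow : ∀ k : ℤ, (f' ^ k) (c y) = c ((f ^ k) y) := by
    intro k
    rw [hf'_def, conj_zpow]
    change c ((f ^ k) (c⁻¹ (c y))) = _
    rw [RelIso.inv_apply_self]
  have hb : autInf f f' ∈ G := (hlat f f' hf.mem hf'.mem).2
  have hb1 : ∀ x, x ≤ autInf f f' x := fun x => le_min (hf.pos x) (hf'.pos x)
  have hb2 : ∀ x, autInf f f' x ≤ f x := fun x => min_le_left _ _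
  have hb3 : ∀ x, autInf f f' x ≤ f' x := fun x => min_le_right _ _
  have hbf := hf.commute_self hb hb1 hb2
  have hbf' := hf'.commute_self hb hb1 hb3
  suffices hk : ∀ k : ℤ, OrbitHull f (c y) ((f' ^ k) (c y)) by
    obtain ⟨m, n, hm, hn⟩ := hz
    refine hR.trans hy ((hk m).of_mem_interval (hk n) ?_ ?_)
    · rw [hpow]; exact c.monotone hm
    · rw [hpow]; exact c.monotone hn
  rcases min_choice (f (c y)) (f' (c y)) with h | h
  · have hle : ∀ k : ℤ, OrbitHull f (c y) ((f' ^ k) (c y)) →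
        OrbitHull f (c y) ((f' ^ (-k)) (c y)) := by
      intro k hk
      have h1 := (hk.of_commute_of_eq hbf h).map_of_commute (hbf'.zpow_right (-k))
      rw [← zpow_add_apply, neg_add_cancel] at h1
      exact hR.symm (h1.mono hb1 hb2)
    have hnn : ∀ (k : ℤ), 0 ≤ k → ∀ x, x ≤ (f ^ k) x := by
      intro k hk x
      obtain ⟨n, rfl⟩ := Int.eq_ofNat_of_zero_le hk
      induction n with
      | zero => exact le_rfl
      | succ n ih =>
        rw [Nat.cast_succ, zpow_add_apply, zpow_one]
        exact (ih (by omega)).trans ((f ^ (n : ℤ)).monotone (hf.pos x))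
    have hyk : ∀ k : ℤ, OrbitHull f (c y) ((f ^ k) y) := fun k =>
      hR.trans (hR.symm hy) (orbitHull_zpow f y k)
    have main : ∃ s : ℤ, (s = 1 ∨ s = -1) ∧ ∀ k : ℤ, 0 ≤ k →
        OrbitHull f (c y) ((f' ^ (s * k)) (c y)) := by
      rcases hcmp with hcmp | hcmp
      · refine ⟨-1, Or.inr rfl, fun k hk => ?_⟩
        rw [hpow, neg_one_mul]
        exact (hyk (-k)).of_mem_interval (hR.refl _) (hcmp _)
          (c.monotone ((zpow_neg_apply_le_iff f k y y).2 (hnn k hk y)))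
      · refine ⟨1, Or.inl rfl, fun k hk => ?_⟩
        rw [hpow, one_mul]
        exact (hR.refl _).of_mem_interval (hyk k) (c.monotone (hnn k hk y)) (hcmp _)
    obtain ⟨s, hs, hmain⟩ := main
    intro k
    rcases le_total 0 k with hk | hk <;> rcases hs with rfl | rfl
    · simpa using hmain k hk
    · simpa using hle _ (hmain k hk)
    · simpa using hle _ (hmain (-k) (by omega))
    · simpa using hmain (-k) (by omega)
  · intro k
    exact ((orbitHull_zpow f' (c y) k).of_commute_of_eq hbf' h).mono hb1 hb2

/-- If the interval `[1, f]` is commutative, an element of `G` mapping some point of the hull of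
an `f`-orbit into that hull maps the whole hull into itself. -/
theorem AbelianBelow.orbitHull_map {G : Subgroup (Ω ≃o Ω)}
    (hlat : SublatticeClosed G) {f c : Ω ≃o Ω} (hf : AbelianBelow G f) (hc : c ∈ G)
    {α y z : Ω} (hy : OrbitHull f α y) (hcy : OrbitHull f α (c y))
    (hz : OrbitHull f α z) : OrbitHull f α (c z) := by
  have hR := OrbitHull.equivalence f
  have hycy := hR.trans (hR.symm hy) hcy
  have hyz := hR.trans (hR.symm hy) hz
  refine hR.trans hy ?_
  rcases le_total z (c z) with h | h
  · have hmem := (hlat c 1 hc G.one_mem).1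
    have h1 := hf.orbitHull_map_of_comparable hlat hmem (Or.inl fun x => le_max_right _ _)
      (y := y) (z := z) ?_ hyz
    · rw [autSup_apply] at h1
      rwa [show (1 : Ω ≃o Ω) z = z from rfl, max_eq_left h] at h1
    · rw [autSup_apply]
      rcases max_choice (c y) ((1 : Ω ≃o Ω) y) with h' | h' <;> rw [h']
      · exact hycy
      · exact hR.refl y
  · have hmem := (hlat c 1 hc G.one_mem).2
    have h1 := hf.orbitHull_map_of_comparable hlat hmem (Or.inr fun x => min_le_right _ _)
      (y := y) (z := z) ?_ hyz
    · rw [autInf_apply] at h1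
      rwa [show (1 : Ω ≃o Ω) z = z from rfl, min_eq_left h] at h1
    · rw [autInf_apply]
      rcases min_choice (c y) ((1 : Ω ≃o Ω) y) with h' | h' <;> rw [h']
      · exact hycy
      · exact hR.refl y

theorem AbelianBelow.orbitHull_of_Vcong {G : Subgroup (Ω ≃o Ω)} (hlat : SublatticeClosed G)
    (htrans : IsTransitive G) {f : Ω ≃o Ω} (hf : AbelianBelow G f) {α x : Ω}
    (hx : Vcong G α (f α) α x) : OrbitHull f α x := by
  have hR := OrbitHull.equivalence f
  let r : Ω → Ω → Prop := fun x y => ∃ c ∈ G, OrbitHull f α (c x) ∧ OrbitHull f α (c y)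
  have key : ∀ {c d : Ω ≃o Ω} {x y : Ω}, c ∈ G → d ∈ G → OrbitHull f α (c x) →
      OrbitHull f α (c y) → OrbitHull f α (d y) → OrbitHull f α (d x) := by
    intro c d x y hc hd hcx hcy hdy
    have h := hf.orbitHull_map hlat (c := d * c⁻¹) (G.mul_mem hd (G.inv_mem hc)) hcy
      (z := c x) (by
        change OrbitHull f α (d (c⁻¹ (c y)))
        rwa [RelIso.inv_apply_self]) hcx
    change OrbitHull f α (d (c⁻¹ (c x))) at h
    rwa [RelIso.inv_apply_self] at h
  have hr : IsConvexCongruence G r := by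
    refine ⟨⟨?_, ?_, ?_⟩, ?_, ?_⟩
    · intro x
      obtain ⟨g, hg, h⟩ := htrans x α
      have : OrbitHull f α (g x) := h ▸ hR.refl α
      exact ⟨g, hg, this, this⟩
    · rintro x y ⟨c, hc, h1, h2⟩
      exact ⟨c, hc, h2, h1⟩
    · rintro x y z ⟨c, hc, h1, h2⟩ ⟨d, hd, h3, h4⟩
      exact ⟨d, hd, key hc hd h1 h2 h3, h4⟩
    · rintro x y z ⟨c, hc, h1, h2⟩ hxy hyz
      exact ⟨c, hc, h1, h1.of_mem_interval h2 (c.monotone hxy) (c.monotone hyz)⟩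
    · rintro g hg x y ⟨c, hc, h1, h2⟩
      refine ⟨c * g⁻¹, G.mul_mem hc (G.inv_mem hg), ?_, ?_⟩
      · change OrbitHull f α (c (g⁻¹ (g x)))
        rwa [RelIso.inv_apply_self]
      · change OrbitHull f α (c (g⁻¹ (g y)))
        rwa [RelIso.inv_apply_self]
  obtain ⟨c, hc, h1, h2⟩ := hx r hr ⟨1, G.one_mem, hR.refl α, orbitHull_apply f α⟩
  exact key hc G.one_mem h2 h1 (hR.refl α)

theorem AbelianBelow.minimalInT {G : Subgroup (Ω ≃o Ω)} (hlat : SublatticeClosed G)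
    (htrans : IsTransitive G) (hample : Ample G) {f : Ω ≃o Ω} (hf : AbelianBelow G f) {α : Ω}
    (hα : f α ≠ α) : MinimalInT G {x | Vcong G α (f α) α x} := by
  refine ⟨inT_Vcong G hα.symm α, ?_⟩
  rintro _ ⟨_, ⟨β, γ, hβγ, rfl⟩, δ, rfl⟩ hsub
  have hs := isConvexCongruence_Vcong G β γ
  have hV := isConvexCongruence_Vcong G α (f α)
  by_cases hcase : Vcong G β γ α (f α)
  · apply hsub.antisymm
    intro x hx
    exact (hV.1.trans (hV.1.symm (hsub (hs.1.refl δ))) hx) _ hs hcase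
  exfalso
  have hΔ := inT_Vcong G hβγ α
  obtain ⟨k, hk⟩ := hample _ hΔ
  obtain ⟨β₀, hβ₀, hkβ₀⟩ := exists_moved_of_mem_Qset htrans hΔ hk
  obtain ⟨⟨hkG, hksupp⟩, -⟩ := hk
  have hsupp : supp (autAbs k) ⊆ {x | Vcong G β γ α x} := by rwa [supp_autAbs]
  have hle : ∀ x, autAbs k x ≤ f x := by
    intro x
    by_cases hx : Vcong G β γ α x
    · by_contra! hlt
      have h1 : Vcong G β γ α (autAbs k x) := mem_of_supp_subset hsupp hx
      exact hcase (hs.1.trans (hs.of_mem_interval hx h1 (hf.pos x) hlt.le)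
        (hs.1.symm (hs.2.2 f hf.mem _ _ hx)))
    · rw [show autAbs k x = x from by_contra fun h => hx (hsupp h)]
      exact hf.pos x
  have hcomm := hf.commute_self (autAbs_mem hlat hkG) (le_autAbs_apply k) hle
  have hmoved : f β₀ ∈ supp (autAbs k) := by
    intro h
    rw [show autAbs k (f β₀) = f (autAbs k β₀) from DFunLike.congr_fun hcomm.eq β₀] at h
    exact hkβ₀ ((autAbs_apply_eq_self_iff k β₀).1 (f.injective h))
  exact hcase (hs.1.trans (hsupp hmoved) (hs.1.symm (hs.2.2 f hf.mem _ _ hβ₀)))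

/-- On a block generated by `α` and `f α`, an element of `G` with a fixed point is trivial. -/
theorem AbelianBelow.eq_self_of_fixed {G : Subgroup (Ω ≃o Ω)} (hlat : SublatticeClosed G)
    (htrans : IsTransitive G) (hample : Ample G) {f : Ω ≃o Ω} (hf : AbelianBelow G f) {α : Ω}
    (hα : f α ≠ α) {g : Ω ≃o Ω} (hg : g ∈ G) (hgα : g α = α) {x : Ω}
    (hx : Vcong G α (f α) α x) : g x = x := by
  by_contra hgx
  have hmin := hf.minimalInT hlat htrans hample hα
  have hV := isConvexCongruence_Vcong G α (f α)
  have hR := OrbitHull.equivalence f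
  have hfx : f x ≠ x := by
    intro h
    have h1 := (hR.symm (hf.orbitHull_of_Vcong hlat htrans hx)).eq_of_fixed h
    exact hα (h1 ▸ h)
  have hb : autInf (autAbs g) f ∈ G := (hlat _ f (autAbs_mem hlat hg) hf.mem).2
  have hb1 : ∀ y, y ≤ autInf (autAbs g) f y := fun y => le_min (le_autAbs_apply g y) (hf.pos y)
  have hb2 : ∀ y, autInf (autAbs g) f y ≤ f y := fun y => min_le_right _ _
  have hbA := hf.of_le hb hb1 hb2
  have hgx' : autAbs g x ≠ x := fun h => hgx ((autAbs_apply_eq_self_iff g x).1 h)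
  have hbx : autInf (autAbs g) f x ≠ x := by
    rw [autInf_apply]
    rcases min_choice (autAbs g x) (f x) with h | h <;> rw [h] <;> assumption
  have hbα : autInf (autAbs g) f α = α := by
    rw [autInf_apply, (autAbs_apply_eq_self_iff g α).2 hgα, min_eq_left (hf.pos α)]
  have hfxV : Vcong G α (f α) α (f x) :=
    hV.1.trans (Vcong_self G α (f α)) (hV.2.2 f hf.mem _ _ hx)
  have hclass := hmin.eq_Vcong_class hx (hV.of_mem_interval hx hfxV (hb1 x) (hb2 x)) hbx.symm
  have hxα : α ∈ {γ | Vcong G x (autInf (autAbs g) f x) x γ} := by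
    rw [hclass]
    exact hV.1.refl α
  have h1 := hbA.orbitHull_of_Vcong hlat htrans hxα
  have h2 := ((OrbitHull.equivalence _).symm h1).eq_of_fixed hbα
  exact hgx (h2 ▸ hgα)

/-- On a block generated by `α` and `f α`, an element of `G` stabilising the block acts as a
power of `f` followed by an element of the interval `[1, f]`. -/
theorem AbelianBelow.exists_zpow_mul {G : Subgroup (Ω ≃o Ω)} (hlat : SublatticeClosed G)
    (htrans : IsTransitive G) (hample : Ample G) {f : Ω ≃o Ω} (hf : AbelianBelow G f) {α : Ω}
    (hα : f α ≠ α) {g : Ω ≃o Ω} (hg : g ∈ G) (hgα : Vcong G α (f α) α (g α)) :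
    ∃ n : ℤ, ∃ r ∈ G, (∀ x, x ≤ r x) ∧ (∀ x, r x ≤ f x) ∧
      ∀ x, Vcong G α (f α) α x → g x = (f ^ n) (r x) := by
  obtain ⟨m, n, hm, hn⟩ := hf.orbitHull_of_Vcong hlat htrans hgα
  have hlt : α < f α := lt_of_le_of_ne (hf.pos α) hα.symm
  have hmono : StrictMono fun z : ℤ => (f ^ z) α := strictMono_int_of_lt_succ fun z => by
    rw [zpow_add_apply, zpow_one]
    exact (f ^ z).strictMono hlt
  obtain ⟨N, hN, hmax⟩ := Int.exists_greatest_of_bdd (P := fun z => (f ^ z) α ≤ g α)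
    ⟨n, fun z hz => hmono.le_iff_le.1 (hz.trans hn)⟩ ⟨m, hm⟩
  have hN' : g α < (f ^ (N + 1)) α := by
    by_contra! h
    have := hmax _ h
    omega
  have hs : f ^ (-N) * g ∈ G := G.mul_mem (G.zpow_mem hf.mem _) hg
  have hs1 : α ≤ (f ^ (-N) * g) α := (le_zpow_neg_apply_iff f N _ _).2 hN
  have hs2 : (f ^ (-N) * g) α ≤ f α := by
    refine (zpow_neg_apply_le_iff f N _ _).2 ?_
    rw [zpow_add_apply, zpow_one] at hN'
    exact hN'.le
  set s := f ^ (-N) * g with hs_def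
  have hsx1 : ∀ x, Vcong G α (f α) α x → x ≤ s x := by
    intro x hx
    have h := hf.eq_self_of_fixed hlat htrans hample hα (hlat s 1 hs G.one_mem).2
      (min_eq_right hs1) hx
    exact min_eq_right_iff.1 h
  have hsx2 : ∀ x, Vcong G α (f α) α x → s x ≤ f x := by
    intro x hx
    have h := hf.eq_self_of_fixed hlat htrans hample hα
      (hlat (f⁻¹ * s) 1 (G.mul_mem (G.inv_mem hf.mem) hs) G.one_mem).1
      (max_eq_right (by
        have := (f⁻¹).monotone hs2
        rwa [RelIso.inv_apply_self] at this)) hx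
    have h1 : f⁻¹ (s x) ≤ x := max_eq_right_iff.1 h
    have h2 := f.monotone h1
    rwa [RelIso.apply_inv_self] at h2
  refine ⟨N, autSup (autInf s f) 1, (hlat _ 1 (hlat s f hs hf.mem).2 G.one_mem).1,
    fun x => le_max_right _ _, fun x => max_le (min_le_right _ _) (hf.pos x), fun x hx => ?_⟩
  have h : autSup (autInf s f) 1 x = s x := by
    rw [autSup_apply, autInf_apply, min_eq_left (hsx2 x hx)]
    exact max_eq_left (hsx1 x hx)
  rw [h, hs_def]
  change _ = (f ^ N) ((f ^ (-N)) (g x))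
  rw [← zpow_add_apply, add_neg_cancel]
  rfl

theorem AbelianBelow.stab_commute {G : Subgroup (Ω ≃o Ω)} (hlat : SublatticeClosed G)
    (htrans : IsTransitive G) (hample : Ample G) {f : Ω ≃o Ω} (hf : AbelianBelow G f) {α : Ω}
    (hα : f α ≠ α) {g₁ g₂ : Ω ≃o Ω} (h₁ : g₁ ∈ stab G {x | Vcong G α (f α) α x})
    (h₂ : g₂ ∈ stab G {x | Vcong G α (f α) α x}) {x : Ω} (hx : Vcong G α (f α) α x) :
    g₁ (g₂ x) = g₂ (g₁ x) := by
  have hV := isConvexCongruence_Vcong G α (f α)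
  have hst : ∀ {g : Ω ≃o Ω}, g ∈ stab G {x | Vcong G α (f α) α x} → ∀ {y : Ω},
      Vcong G α (f α) α y → Vcong G α (f α) α (g y) := by
    intro g hg y hy
    have : g y ∈ g '' {x | Vcong G α (f α) α x} := ⟨y, hy, rfl⟩
    rw [hg.2] at this
    exact this
  obtain ⟨n₁, r₁, hr₁, p₁, q₁, e₁⟩ :=
    hf.exists_zpow_mul hlat htrans hample hα h₁.1 (hst h₁ (hV.1.refl α))
  obtain ⟨n₂, r₂, hr₂, p₂, q₂, e₂⟩ :=
    hf.exists_zpow_mul hlat htrans hample hα h₂.1 (hst h₂ (hV.1.refl α))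
  rw [e₁ _ (hst h₂ hx), e₂ _ hx, e₂ _ (hst h₁ hx), e₁ _ hx]
  have c₁ := (hf.commute_self hr₁ p₁ q₁).zpow_right n₂
  have c₂ := (hf.commute_self hr₂ p₂ q₂).zpow_right n₁
  have c := hf.comm r₁ hr₁ r₂ hr₂ p₁ q₁ p₂ q₂
  have cf := Commute.zpow_zpow_self f n₁ n₂
  exact DFunLike.congr_fun ((cf.mul_right c₂.symm).mul_left (c₁.mul_right c)).eq x

/-- (Lemma 5.6 of the paper.) -/
theorem minimal_abelian_component_iff {Ω : Type*} [LinearOrder Ω]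
    (G : Subgroup (Ω ≃o Ω)) (hlat : SublatticeClosed G)
    (htrans : IsTransitive G) (hample : Ample G) :
    ((∃ Δ : Set Ω, MinimalInT G Δ ∧
        ∀ g₁ ∈ stab G Δ, ∀ g₂ ∈ stab G Δ, ∀ α ∈ Δ, g₁ (g₂ α) = g₂ (g₁ α)) ↔
      (∃ h₁ : Ω ≃o Ω, h₁ ∈ G ∧ autLe 1 h₁ ∧ h₁ ≠ 1 ∧
        ∀ a b : Ω ≃o Ω, a ∈ G → b ∈ G →
          autLe (autSup (autAbs a) (autAbs b)) h₁ → pcomm a b = 1)) ∧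
    (∀ Δ : Set Ω, MinimalInT G Δ →
      (∀ g₁ ∈ stab G Δ, ∀ g₂ ∈ stab G Δ, ∀ α ∈ Δ, g₁ (g₂ α) = g₂ (g₁ α)) →
      ∀ h₁ ∈ Qset G Δ, ∀ x ∈ G,
        (x ∈ rst G Δ ↔ ∃ h ∈ Qset G Δ, autLe h₁ h ∧ autLe (autAbs x) h ∧
          ∀ y ∈ G, autLe (autAbs y) h → pcomm x y = 1)) := by
  refine ⟨⟨?_, ?_⟩, ?_⟩
  · rintro ⟨Δ, hΔ, hab⟩
    obtain ⟨h, hh⟩ := hample Δ hΔ.1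
    obtain ⟨α, -, hα⟩ := exists_moved_of_mem_Qset htrans hΔ.1 hh
    have hsupp : supp (autAbs h) ⊆ Δ := by
      rw [supp_autAbs]
      exact hh.1.2
    refine ⟨autAbs h, autAbs_mem hlat hh.1.1, le_autAbs_apply h, fun h1 => hα ?_, ?_⟩
    · rw [← autAbs_apply_eq_self_iff, h1]
      rfl
    · intro a b ha hb hle
      have hsa : supp a ⊆ Δ := (supp_subset_of_autAbs_le fun x =>
        (le_max_left _ _).trans (hle x)).trans hsupp
      have hsb : supp b ⊆ Δ := (supp_subset_of_autAbs_le fun x =>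
        (le_max_right _ _).trans (hle x)).trans hsupp
      exact (pcomm_eq_one_iff a b).2 (commute_of_supp_subset hsa hsb
        (hab a ⟨ha, image_eq_of_supp_subset hsa⟩ b ⟨hb, image_eq_of_supp_subset hsb⟩))
  · rintro ⟨f, hfG, hpos, hne, hab⟩
    have hf : AbelianBelow G f := by
      refine ⟨hfG, hpos, fun a ha b hb a1 a2 b1 b2 => ?_⟩
      rw [← pcomm_eq_one_iff]
      apply hab a b ha hb
      rw [autAbs_eq_self a1, autAbs_eq_self b1]
      exact fun x => max_le (a2 x) (b2 x)
    obtain ⟨α, hα⟩ : ∃ α, f α ≠ α := by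
      by_contra! h
      exact hne (by ext x; exact h x)
    exact ⟨_, hf.minimalInT hlat htrans hample hα, fun g₁ h₁ g₂ h₂ x hx =>
      hf.stab_commute hlat htrans hample hα h₁ h₂ hx⟩
  · intro Δ hΔ hab h₁ hh₁ x hx
    constructor
    · intro hxΔ
      obtain ⟨α, hαΔ, hα⟩ := exists_moved_of_mem_Qset htrans hΔ.1 hh₁
      have hle₁ : autLe (autAbs h₁) (autSup (autAbs h₁) (autAbs x)) := fun y => le_max_left _ _
      have hsupp : supp (autSup (autAbs h₁) (autAbs x)) ⊆ Δ := by
        intro y hy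
        by_contra hyΔ
        have e₁ : autAbs h₁ y = y :=
          (autAbs_apply_eq_self_iff h₁ y).2 (by_contra fun h => hyΔ (hh₁.1.2 h))
        have e₂ : autAbs x y = y :=
          (autAbs_apply_eq_self_iff x y).2 (by_contra fun h => hyΔ (hxΔ.2 h))
        exact hy (by rw [autSup_apply, e₁, e₂, max_self])
      have hmoved : autSup (autAbs h₁) (autAbs x) α ≠ α := by
        intro h
        refine hα ((autAbs_apply_eq_self_iff h₁ α).1 (le_antisymm ?_ (le_autAbs_apply h₁ α)))
        exact (hle₁ α).trans_eq h
      refine ⟨autSup (autAbs h₁) (autAbs x), ⟨⟨(hlat _ _ (autAbs_mem hlat hh₁.1.1)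
        (autAbs_mem hlat hx)).1, hsupp⟩, α, hαΔ, ?_⟩, fun y => (le_max_left _ _).trans (hle₁ y),
        fun y => le_max_right _ _, fun y hy hyle => ?_⟩
      · exact (hΔ.eq_Vcong_class hαΔ (mem_of_supp_subset hsupp hαΔ) hmoved.symm).symm
      · have hsy : supp y ⊆ Δ := (supp_subset_of_autAbs_le hyle).trans hsupp
        exact (pcomm_eq_one_iff x y).2 (commute_of_supp_subset hxΔ.2 hsy
          (hab x ⟨hx, image_eq_of_supp_subset hxΔ.2⟩ y ⟨hy, image_eq_of_supp_subset hsy⟩))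
    · rintro ⟨h, hh, -, hxh, -⟩
      exact ⟨hx, (supp_subset_of_autAbs_le hxh).trans hh.1.2⟩

end LPerm
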